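/- Let X and Y be compact metric spaces equipped with finite Borel measures m_X and m_Y, and let f : X → Y be a homeomorphism. Let p : X × X × (0,∞) → [0,∞) and q : Y × Y × (0,∞) → [0,∞) be jointly Borel measurable kernels such that: (i) q(f(x), f(x'), t) = p(x, x', t) for all x, x' ∈ X and t > 0; (ii) q is symmetric in its first two arguments: q(y, y', t) = q(y', y, t) for all y, y' ∈ Y, t > 0; (iii) p has unit mass: ∫_X p(x, x', t) dm_X(x) = 1 for every x' ∈ X and t > 0; (iv) q reproduces continuous functions: for every continuous ψ : Y → ℝ and every y' ∈ Y, ∫_Y ψ(y)·q(y, y', t) dm_Y(y) → ψ(y') as t → 0⁺; and (v) there exists C > 0 with ∫_Y q(y, y', t) dm_Y(y) ≤ C for every y' ∈ Y and every t ∈ (0,1]. Then the pushforward measure f_♯m_X equals m_Y. -/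

import Mathlib

open Filter Set MeasureTheory

/-- A homeomorphism between compact metric measure spaces that intertwines two
kernels with the stated unit mass, symmetry, reproducing and boundedness
properties must push the first measure forward to the second. -/
theorem map_measure_eq_of_kernel_intertwining
    {X Y : Type*} [MetricSpace X] [CompactSpace X] [MetricSpace Y] [CompactSpace Y]
    [MeasurableSpace X] [BorelSpace X] [MeasurableSpace Y] [BorelSpace Y]
    (mX : Measure X) (mY : Measure Y) [IsFiniteMeasure mX] [IsFiniteMeasure mY]
    (f : X ≃ₜ Y)
    (p : X → X → ℝ → ℝ) (q : Y → Y → ℝ → ℝ)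
    (hp_nonneg : ∀ x x' : X, ∀ t : ℝ, 0 < t → 0 ≤ p x x' t)
    (hq_nonneg : ∀ y y' : Y, ∀ t : ℝ, 0 < t → 0 ≤ q y y' t)
    (hp_meas : Measurable fun z : X × X × ℝ => p z.1 z.2.1 z.2.2)
    (hq_meas : Measurable fun z : Y × Y × ℝ => q z.1 z.2.1 z.2.2)
    (hcomp : ∀ x x' : X, ∀ t : ℝ, 0 < t → q (f x) (f x') t = p x x' t)
    (hsymm : ∀ y y' : Y, ∀ t : ℝ, 0 < t → q y y' t = q y' y t)
    (hmass : ∀ x' : X, ∀ t : ℝ, 0 < t → ∫ x, p x x' t ∂mX = 1)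
    (hrepr : ∀ ψ : C(Y, ℝ), ∀ y' : Y,
      Tendsto (fun t : ℝ => ∫ y, ψ y * q y y' t ∂mY) (nhdsWithin 0 (Ioi 0))
        (nhds (ψ y')))
    (hbdd : ∃ C : ℝ, 0 < C ∧ ∀ y' : Y, ∀ t : ℝ, t ∈ Ioc (0:ℝ) 1 →
      ∫ y, q y y' t ∂mY ≤ C) :
    mX.map f = mY := by
  obtain ⟨C, hC, hbdd⟩ := hbdd
  have hfm : Measurable f := f.continuous.measurable
  have hfin : IsFiniteMeasure (mX.map f) := inferInstance
  have hq2 : ∀ t : ℝ, Measurable fun z : Y × Y => q z.1 z.2 t := fun t =>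
    hq_meas.comp (measurable_fst.prodMk (measurable_snd.prodMk measurable_const))
  have hmassY : ∀ y : Y, ∀ t : ℝ, 0 < t → ∫ y', q y y' t ∂(mX.map f) = 1 := by
    intro y t ht
    obtain ⟨x, rfl⟩ := f.surjective y
    have hm : Measurable fun y' : Y => q (f x) y' t :=
      (hq2 t).comp (measurable_const.prodMk measurable_id)
    rw [integral_map hfm.aemeasurable hm.aestronglyMeasurable]
    rw [← hmass x t ht]
    refine integral_congr_ae (Eventually.of_forall fun x' => ?_)
    change q (f x) (f x') t = p x' x t
    rw [hsymm _ _ t ht, hcomp _ _ t ht]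
  generalize mX.map f = μ at *
  -- integrability of the kernel on the product
  have hint : ∀ t : ℝ, 0 < t → Integrable (fun z : Y × Y => q z.1 z.2 t) (mY.prod μ) := by
    intro t ht
    rw [integrable_prod_iff (hq2 t).aestronglyMeasurable]
    constructor
    · refine Eventually.of_forall fun y => ?_
      by_contra h
      have h1 := hmassY y t ht
      rw [integral_undef h] at h1
      exact zero_ne_one h1
    · have : (fun y => ∫ y', ‖q y y' t‖ ∂μ) = fun _ => (1 : ℝ) := by
        funext y
        rw [← hmassY y t ht]
        refine integral_congr_ae (Eventually.of_forall fun y' => ?_)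
        exact Real.norm_of_nonneg (hq_nonneg _ _ t ht)
      simp only [this]
      exact integrable_const _
  refine ext_of_forall_integral_eq_of_IsFiniteMeasure fun ψ => ?_
  have hψ : ∀ y, ‖ψ y‖ ≤ ‖ψ‖ := ψ.norm_coe_le_norm
  have hψm : Measurable ψ := ψ.continuous.measurable
  have hint2 : ∀ t : ℝ, 0 < t →
      Integrable (fun z : Y × Y => ψ z.1 * q z.1 z.2 t) (mY.prod μ) := by
    intro t ht
    exact (hint t ht).bdd_mul (c := ‖ψ‖) (hψm.comp measurable_fst).aestronglyMeasurable
      (Eventually.of_forall fun z => hψ z.1)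
  have hswap : ∀ t : ℝ, 0 < t → ∫ y', ∫ y, ψ y * q y y' t ∂mY ∂μ = ∫ y, ψ y ∂mY := by
    intro t ht
    rw [← integral_integral_swap (f := fun y y' => ψ y * q y y' t) (hint2 t ht)]
    refine integral_congr_ae (Eventually.of_forall fun y => ?_)
    change ∫ y', ψ y * q y y' t ∂μ = ψ y
    rw [integral_const_mul, hmassY y t ht, mul_one]
  have hpos : ∀ᶠ t : ℝ in nhdsWithin 0 (Ioi 0), t ∈ Ioc (0:ℝ) 1 :=
    Ioc_mem_nhdsGT one_pos
  have hlim : Tendsto (fun t : ℝ => ∫ y', ∫ y, ψ y * q y y' t ∂mY ∂μ)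
      (nhdsWithin 0 (Ioi 0)) (nhds (∫ y', ψ y' ∂μ)) := by
    refine tendsto_integral_filter_of_dominated_convergence (fun _ => ‖ψ‖ * C) ?_ ?_
      (integrable_const _) (Eventually.of_forall fun y' => hrepr ψ.toContinuousMap y')
    · filter_upwards [hpos] with t ht
      exact (hint2 t ht.1).integral_prod_right.aestronglyMeasurable
    · filter_upwards [hpos] with t ht
      filter_upwards [(hint t ht.1).prod_left_ae] with y' hy'
      calc ‖∫ y, ψ y * q y y' t ∂mY‖ ≤ ∫ y, ‖ψ‖ * q y y' t ∂mY := by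
            refine norm_integral_le_of_norm_le (hy'.const_mul _) (Eventually.of_forall fun y => ?_)
            rw [norm_mul, Real.norm_of_nonneg (hq_nonneg y y' t ht.1)]
            exact mul_le_mul_of_nonneg_right (hψ y) (hq_nonneg y y' t ht.1)
        _ = ‖ψ‖ * ∫ y, q y y' t ∂mY := integral_const_mul _ _
        _ ≤ ‖ψ‖ * C := mul_le_mul_of_nonneg_left (hbdd y' t ht) (norm_nonneg _)
  refine tendsto_nhds_unique hlim (tendsto_const_nhds.congr' ?_)
  filter_upwards [hpos] with t ht
  exact (hswap t ht.1).symm
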